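/- Let p be a prime and let G be a finite abelian p-group with exponent n = exp(G). Then s_{nℕ⁺}(G) = D(G) + n − 1, where s_{nℕ⁺}(G) is the smallest positive integer ℓ such that every sequence over G of length at least ℓ contains a nonempty zero-sum subsequence whose length is divisible by n. -/

import Mathlib

/-- The zero-sum invariant `s_L(G)`: the smallest positive integer `ℓ` such that every
sequence (multiset) over `G` of length at least `ℓ` contains a nonempty zero-sum
subsequence whose length lies in `L`. -/
noncomputable def zsInv (G : Type*) [AddCommGroup G] (L : Set ℕ) : ℕ :=
  sInf {ℓ : ℕ | 0 < ℓ ∧ ∀ S : Multiset G, ℓ ≤ Multiset.card S →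
    ∃ T : Multiset G, T ≤ S ∧ T ≠ 0 ∧ T.sum = 0 ∧ Multiset.card T ∈ L}

/-- The Davenport constant `D(G)`. -/
noncomputable def davenport (G : Type*) [AddCommGroup G] : ℕ := zsInv G {t | 0 < t}

/-- The η-invariant `η(G) = s_{[1, exp(G)]}(G)`. -/
noncomputable def etaInv (G : Type*) [AddCommGroup G] : ℕ :=
  zsInv G {t | 0 < t ∧ t ≤ AddMonoid.exponent G}

/-- The Erdős–Ginzburg–Ziv constant `s(G) = s_{{exp(G)}}(G)`. -/
noncomputable def egzConst (G : Type*) [AddCommGroup G] : ℕ :=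
  zsInv G {AddMonoid.exponent G}

/-- `η_i(G) = s_{[i, exp(G)]}(G)`. -/
noncomputable def etaI (G : Type*) [AddCommGroup G] (i : ℕ) : ℕ :=
  zsInv G {t | i ≤ t ∧ t ≤ AddMonoid.exponent G}

/-- `ζ_i(G) = s_{[i-n,0] + nℕ⁺}(G)` where `n = exp(G)`: the invariant for zero-sum
subsequences whose length is congruent mod `n` to some residue `r` with `i ≤ r ≤ n`. -/
noncomputable def zetaI (G : Type*) [AddCommGroup G] (i : ℕ) : ℕ :=
  zsInv G {t | 0 < t ∧ ∃ r : ℕ, i ≤ r ∧ r ≤ AddMonoid.exponent G ∧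
    t % AddMonoid.exponent G = r % AddMonoid.exponent G}

theorem Multiset.exists_le_map_eq_of_le_map {α β : Type*} {f : α → β} {S : Multiset α}
    {T : Multiset β} (h : T ≤ S.map f) : ∃ U ≤ S, U.map f = T := by
  induction S using Multiset.induction_on generalizing T with
  | empty => exact ⟨0, le_rfl, by simpa [eq_comm] using h⟩
  | cons a S ih =>
    rw [Multiset.map_cons] at h
    by_cases ha : f a ∈ T
    · obtain ⟨T', rfl⟩ := Multiset.exists_cons_of_mem ha
      obtain ⟨U, hU, rfl⟩ := ih ((Multiset.cons_le_cons_iff _).1 h)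
      exact ⟨a ::ₘ U, Multiset.cons_le_cons _ hU, by simp⟩
    · obtain ⟨U, hU, rfl⟩ := ih ((Multiset.le_cons_of_notMem ha).1 h)
      exact ⟨U, hU.trans (Multiset.le_cons_self _ _), rfl⟩

/-- To compute `zsInv G L` it suffices to exhibit the threshold. -/
theorem zsInv_eq_succ {G : Type*} [AddCommGroup G] {L : Set ℕ} {m : ℕ}
    (hgood : ∀ S : Multiset G, m + 1 ≤ Multiset.card S →
      ∃ T : Multiset G, T ≤ S ∧ T ≠ 0 ∧ T.sum = 0 ∧ Multiset.card T ∈ L)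
    (hbad : ∃ S : Multiset G, Multiset.card S = m ∧
      ∀ T ≤ S, T.sum = 0 → Multiset.card T ∈ L → T = 0) :
    zsInv G L = m + 1 := by
  refine le_antisymm (Nat.sInf_le ⟨m.succ_pos, hgood⟩) ?_
  refine le_csInf ⟨m + 1, m.succ_pos, hgood⟩ ?_
  rintro ℓ ⟨-, hℓ⟩
  by_contra! hlt
  obtain ⟨S, hS, hST⟩ := hbad
  obtain ⟨T, hTS, hT, hsum, hcard⟩ := hℓ S (by omega)
  exact hT (hST T hTS hsum hcard)

theorem sum_pow_eq_zero_of_pow_succ_eq_zero {R ι : Type*} [CommSemiring R] (s : Finset ι)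
    (x : ι → R) (m : ι → ℕ) (hx : ∀ i, x i ^ (m i + 1) = 0) :
    (∑ i ∈ s, x i) ^ (∑ i ∈ s, m i + 1) = 0 := by
  classical
  induction s using Finset.induction_on with
  | empty => simp
  | insert a s ha ih =>
    rw [Finset.sum_insert ha, Finset.sum_insert ha]
    exact (Commute.all _ _).add_pow_eq_zero_of_add_le_succ_of_pow_eq_zero (hx a) ih (by omega)

namespace AddMonoidAlgebra

variable {R H : Type*} [CommRing R] [AddCommGroup H]

theorem exists_le_sum_eq_of_coeff_prod_ne_zero (S : Multiset H) {h : H}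
    (hh : ((S.map fun g => (1 - single g 1 : AddMonoidAlgebra R H)).prod).coeff h ≠ 0) :
    ∃ T ≤ S, T.sum = h := by
  induction S using Multiset.induction_on generalizing h with
  | empty =>
    refine ⟨0, le_rfl, ?_⟩
    by_contra hne
    simp only [Multiset.sum_zero] at hne
    simp [one_def, hne] at hh
  | cons a S ih =>
    rw [Multiset.map_cons, Multiset.prod_cons, sub_mul, one_mul, coeff_sub, Finsupp.sub_apply,
      coeff_single_mul_apply, one_mul] at hh
    by_cases h0 : ((S.map fun g => (1 - single g 1 : AddMonoidAlgebra R H)).prod).coeff h = 0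
    · rw [h0, zero_sub, neg_ne_zero] at hh
      obtain ⟨T, hT, hs⟩ := ih hh
      exact ⟨a ::ₘ T, Multiset.cons_le_cons _ hT, by simp [hs]⟩
    · obtain ⟨T, hT, hs⟩ := ih h0
      exact ⟨T, hT.trans (Multiset.le_cons_self _ _), hs⟩

theorem coeff_zero_prod_eq_one_of_zeroSumFree (S : Multiset H)
    (hS : ∀ T ≤ S, T.sum = 0 → T = 0) :
    ((S.map fun g => (1 - single g 1 : AddMonoidAlgebra R H)).prod).coeff 0 = 1 := by
  induction S using Multiset.induction_on with
  | empty => simp [one_def]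
  | cons a S ih =>
    rw [Multiset.map_cons, Multiset.prod_cons, sub_mul, one_mul, coeff_sub, Finsupp.sub_apply,
      coeff_single_mul_apply, one_mul,
      ih fun T hT => hS T (hT.trans (Multiset.le_cons_self _ _)), sub_eq_self]
    by_contra hne
    obtain ⟨T, hT, hs⟩ := exists_le_sum_eq_of_coeff_prod_ne_zero S hne
    exact Multiset.cons_ne_zero (hS (a ::ₘ T) (Multiset.cons_le_cons _ hT) (by simp [hs]))

/-- The elements `g` with `1 - single g 1` in a given ideal form a subgroup. -/
def subgroupOfIdeal (I : Ideal (AddMonoidAlgebra R H)) : AddSubgroup H where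
  carrier := {g | 1 - single g 1 ∈ I}
  zero_mem' := by simp [one_def]
  add_mem' {g h} hg hh := by
    have : (1 - single (g + h) 1 : AddMonoidAlgebra R H) =
        (1 - single g 1) + single g 1 * (1 - single h 1) := by
      rw [mul_sub, single_mul_single, mul_one, mul_one]; ring
    rw [Set.mem_ofPred_eq, this]
    exact I.add_mem hg (I.mul_mem_left _ hh)
  neg_mem' {g} hg := by
    have : (1 - single (-g) 1 : AddMonoidAlgebra R H) =
        -(single (-g) 1 * (1 - single g 1)) := by
      rw [mul_sub, single_mul_single, mul_one, mul_one, neg_add_cancel, ← one_def]; ring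
    rw [Set.mem_ofPred_eq, this]
    exact I.neg_mem (I.mul_mem_left _ hg)

end AddMonoidAlgebra

open AddMonoidAlgebra in
/-- Olson's upper bound for the Davenport constant of a product of cyclic `p`-groups. -/
theorem exists_zeroSum_of_lt_card {p : ℕ} [Fact p.Prime] {ι : Type*} [Fintype ι] (e : ι → ℕ)
    (S : Multiset (∀ i, ZMod (p ^ e i))) (hS : ∑ i, (p ^ e i - 1) < Multiset.card S) :
    ∃ T ≤ S, T ≠ 0 ∧ T.sum = 0 := by
  classical
  by_contra! hcon
  have hpos (i : ι) : 0 < p ^ e i := pow_pos (Fact.out : p.Prime).pos _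
  let A := AddMonoidAlgebra (ZMod p) (∀ i, ZMod (p ^ e i))
  have : CharP A p := charP_of_injective_algebraMap' (ZMod p) p
  let x : ι → A := fun i => 1 - single (Pi.single i 1) 1
  have hx (i : ι) : x i ^ (p ^ e i - 1 + 1) = 0 := by
    rw [Nat.sub_add_cancel (hpos i), sub_pow_char_pow, one_pow, single_pow, one_pow,
      ← Pi.single_smul, nsmul_one, ZMod.natCast_self, Pi.single_zero, ← one_def, sub_self]
  let I : Ideal A := ∑ i, Ideal.span {x i}
  have hI : I ^ (∑ i, (p ^ e i - 1) + 1) = 0 :=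
    sum_pow_eq_zero_of_pow_succ_eq_zero _ _ _ fun i => by
      rw [Ideal.span_singleton_pow, hx]; simp
  have hmem (g : ∀ i, ZMod (p ^ e i)) : 1 - single g 1 ∈ I := by
    change g ∈ subgroupOfIdeal I
    rw [← Finset.univ_sum_single g]
    refine sum_mem fun i _ => ?_
    have hgen : Pi.single i 1 ∈ subgroupOfIdeal I := by
      have hle : Ideal.span {x i} ≤ I :=
        Finset.single_le_sum (f := fun i => Ideal.span {x i}) (fun _ _ => bot_le)
          (Finset.mem_univ i)
      exact hle (Ideal.mem_span_singleton_self _)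
    have : NeZero (p ^ e i) := ⟨(hpos i).ne'⟩
    have hval : Pi.single i (g i) = (g i).val • (Pi.single i 1 : ∀ i, ZMod (p ^ e i)) := by
      rw [← Pi.single_smul]; simp
    exact hval ▸ nsmul_mem hgen _
  have hprod (U : Multiset (∀ i, ZMod (p ^ e i))) :
      (U.map fun g => (1 - single g 1 : A)).prod ∈ I ^ Multiset.card U := by
    induction U using Multiset.induction_on with
    | empty => simp
    | cons a U ih =>
      rw [Multiset.map_cons, Multiset.prod_cons, Multiset.card_cons, pow_succ']
      exact Ideal.mul_mem_mul (hmem a) ih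
  have hzero : (S.map fun g => (1 - single g 1 : A)).prod = 0 := by
    have := Ideal.pow_le_pow_right hS (hprod S)
    rwa [hI] at this
  have hone := coeff_zero_prod_eq_one_of_zeroSumFree (R := ZMod p) S fun T hT hs =>
    by_contra fun h => hcon T hT h hs
  change ((S.map fun g => (1 - single g 1 : A)).prod).coeff 0 = 1 at hone
  rw [hzero] at hone
  simp at hone

/-- The standard zero-sum free sequence over a product of cyclic groups. -/
theorem exists_zeroSumFree_card_eq {ι : Type*} [Fintype ι] (q : ι → ℕ) (hq : ∀ i, 0 < q i) :
    ∃ S : Multiset (∀ i, ZMod (q i)), Multiset.card S = ∑ i, (q i - 1) ∧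
      ∀ T ≤ S, T.sum = 0 → T = 0 := by
  classical
  let S₀ : Multiset ι := ∑ i, Multiset.replicate (q i - 1) i
  refine ⟨S₀.map fun i => Pi.single i 1, by simp [S₀], fun T hT hs => ?_⟩
  obtain ⟨U, hU, rfl⟩ := Multiset.exists_le_map_eq_of_le_map hT
  have hsum (V : Multiset ι) (j : ι) :
      (V.map fun i => (Pi.single i 1 : ∀ i, ZMod (q i))).sum j = (V.count j : ZMod (q j)) := by
    induction V using Multiset.induction_on with
    | empty => simp
    | cons a V ih =>
      rw [Multiset.map_cons, Multiset.sum_cons, Pi.add_apply, ih, Multiset.count_cons]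
      by_cases h : j = a
      · subst h; simp [add_comm]
      · simp [h]
  have hcount (j : ι) : U.count j = 0 := by
    have hle := Multiset.count_le_of_le j hU
    have hS₀ : S₀.count j = q j - 1 := by
      simp [S₀, Multiset.count_sum', Multiset.count_replicate]
    have hdvd : q j ∣ U.count j := by
      rw [← ZMod.natCast_eq_zero_iff, ← hsum, hs, Pi.zero_apply]
    exact Nat.eq_zero_of_dvd_of_lt hdvd (by have := hq j; omega)
  have : U = 0 := Multiset.ext' fun j => by simp [hcount j]
  simp [this]

/-- A finite abelian `p`-group is a product of cyclic `p`-groups. -/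
theorem exists_addEquiv_pi_zmod_prime_pow {p : ℕ} (hp : p.Prime) (G : Type*) [AddCommGroup G]
    [Finite G] {k : ℕ} (hk : AddMonoid.exponent G = p ^ k) :
    ∃ (ι : Type) (_ : Fintype ι) (e : ι → ℕ), Nonempty (G ≃+ ∀ i, ZMod (p ^ e i)) := by
  classical
  obtain ⟨ι, _, r, -, f, ⟨φ⟩⟩ := AddCommGroup.equiv_directSum_zmod_of_finite G
  let ψ : G ≃+ ∀ i, ZMod (r i ^ f i) := φ.trans (DirectSum.addEquivProd _)
  have hpow (i : ι) : ∃ m, r i ^ f i = p ^ m := by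
    have hdvd : r i ^ f i ∣ p ^ k := by
      rw [← ZMod.natCast_eq_zero_iff]
      have h0 : p ^ k • (Pi.single i 1 : ∀ i, ZMod (r i ^ f i)) = 0 := by
        rw [← ψ.apply_symm_apply (Pi.single i 1), ← map_nsmul, ← hk,
          AddMonoid.exponent_nsmul_eq_zero, map_zero]
      simpa using congr_fun h0 i
    obtain ⟨m, -, hm⟩ := (Nat.dvd_prime_pow hp).1 hdvd
    exact ⟨m, hm⟩
  choose e he using hpow
  exact ⟨ι, inferInstance, e,
    ⟨ψ.trans (AddEquiv.piCongrRight fun i => (ZMod.ringEquivCongr (he i)).toAddEquiv)⟩⟩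

theorem exponent_eq_prime_pow {p : ℕ} (hp : p.Prime) (G : Type*) [AddCommGroup G] [Finite G]
    (hpG : ∀ g : G, ∃ k : ℕ, p ^ k • g = 0) : ∃ k, AddMonoid.exponent G = p ^ k := by
  have := Fintype.ofFinite G
  choose κ hκ using hpG
  have hdvd : AddMonoid.exponent G ∣ p ^ ∑ g, κ g :=
    AddMonoid.exponent_dvd_of_forall_nsmul_eq_zero fun g => by
      obtain ⟨c, hc⟩ := pow_dvd_pow p
        (Finset.single_le_sum (f := κ) (fun _ _ => Nat.zero_le _) (Finset.mem_univ g))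
      rw [hc, mul_comm, mul_nsmul', hκ, nsmul_zero]
  obtain ⟨k, -, hk⟩ := (Nat.dvd_prime_pow hp).1 hdvd
  exact ⟨k, hk⟩

/-- For a finite abelian `p`-group `G` with `n = exp(G)`,
`s_{nℕ⁺}(G) = D(G) + n − 1`. -/
theorem stmt15 (p : ℕ) (hp : p.Prime) (G : Type*) [AddCommGroup G] [Finite G]
    (hpG : ∀ g : G, ∃ k : ℕ, p ^ k • g = 0) :
    zsInv G {t | 0 < t ∧ AddMonoid.exponent G ∣ t} =
      davenport G + AddMonoid.exponent G - 1 := by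
  have : Fact p.Prime := ⟨hp⟩
  obtain ⟨k, hk⟩ := exponent_eq_prime_pow hp G hpG
  obtain ⟨ι, _, e, ⟨φ⟩⟩ := exists_addEquiv_pi_zmod_prime_pow hp G hk
  have hn : 0 < p ^ k := pow_pos hp.pos _
  set d := ∑ i, (p ^ e i - 1)
  obtain ⟨S₀, hS₀card, hS₀⟩ :
      ∃ S : Multiset G, Multiset.card S = d ∧ ∀ T ≤ S, T.sum = 0 → T = 0 := by
    obtain ⟨S, hcard, hS⟩ :=
      exists_zeroSumFree_card_eq (fun i => p ^ e i) fun i => pow_pos hp.pos _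
    refine ⟨S.map φ.symm, by simpa using hcard, fun T hT hs => ?_⟩
    obtain ⟨U, hU, rfl⟩ := Multiset.exists_le_map_eq_of_le_map hT
    rw [← map_multiset_sum, map_eq_zero_iff _ φ.symm.injective] at hs
    simp [hS U hU hs]
  have hD : davenport G = d + 1 := by
    refine zsInv_eq_succ (fun S hS => ?_) ⟨S₀, hS₀card, fun T hT hs _ => hS₀ T hT hs⟩
    obtain ⟨T, hT, hT0, hs⟩ := exists_zeroSum_of_lt_card e (S.map φ) (by simpa using hS)
    obtain ⟨U, hU, rfl⟩ := Multiset.exists_le_map_eq_of_le_map hT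
    rw [← map_multiset_sum, map_eq_zero_iff _ φ.injective] at hs
    have hU0 : U ≠ 0 := by rintro rfl; simp at hT0
    exact ⟨U, hU, hU0, hs, Multiset.card_pos.2 hU0⟩
  have hmain : zsInv G {t | 0 < t ∧ AddMonoid.exponent G ∣ t} = d + (p ^ k - 1) + 1 := by
    rw [hk]
    refine zsInv_eq_succ (fun S hS => ?_) ?_
    · let e' : Option ι → ℕ := fun o => o.elim k e
      let f : G → ∀ o, ZMod (p ^ e' o) := fun g o =>
        match o with
        | none => (1 : ZMod (p ^ k))
        | some i => φ g i
      obtain ⟨T, hT, hT0, hs⟩ := exists_zeroSum_of_lt_card e' (S.map f) (by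
        rw [Fintype.sum_option, Multiset.card_map]
        change p ^ k - 1 + d < _
        omega)
      obtain ⟨U, hU, rfl⟩ := Multiset.exists_le_map_eq_of_le_map hT
      have hU0 : U ≠ 0 := by rintro rfl; simp at hT0
      have hnone (V : Multiset G) :
          (V.map f).sum none = ((Multiset.card V : ℕ) : ZMod (p ^ k)) := by
        induction V using Multiset.induction_on with
        | empty => simp; rfl
        | cons a V ih =>
          rw [Multiset.map_cons, Multiset.sum_cons, Pi.add_apply, ih, Multiset.card_cons,
            Nat.cast_succ, add_comm]
          rfl
      have hsome (V : Multiset G) (i : ι) : (V.map f).sum (some i) = φ V.sum i := by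
        induction V using Multiset.induction_on with
        | empty => simp; rfl
        | cons a V ih =>
          rw [Multiset.map_cons, Multiset.sum_cons, Pi.add_apply, ih, Multiset.sum_cons,
            map_add, Pi.add_apply]
          rfl
      refine ⟨U, hU, hU0, ?_, Multiset.card_pos.2 hU0, ?_⟩
      · rw [← map_eq_zero_iff _ φ.injective]
        funext i
        rw [← hsome, hs]; rfl
      · rw [← ZMod.natCast_eq_zero_iff, ← hnone, hs]; rfl
    · classical
      refine ⟨S₀ + Multiset.replicate (p ^ k - 1) 0, by simp [hS₀card], ?_⟩
      rintro T hT hs ⟨hpos, hdvd⟩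
      exfalso
      obtain ⟨A, hA, B, hB, rfl⟩ : ∃ A ≤ S₀, ∃ B ≤ Multiset.replicate (p ^ k - 1) (0 : G),
          T = A + B :=
        ⟨T ∩ S₀, Multiset.inter_le_right, T - S₀, by
          rw [tsub_le_iff_left]; exact hT, by rw [add_comm, Multiset.sub_add_inter]⟩
      obtain ⟨m, hm, rfl⟩ := Multiset.le_replicate_iff.1 hB
      obtain rfl : A = 0 := hS₀ A hA (by simpa using hs)
      simp only [zero_add, Multiset.card_replicate] at hpos hdvd
      have := Nat.le_of_dvd hpos hdvd
      omega
  rw [hmain, hD, hk]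
  omega
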